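/- arXiv:1701.03677 — 6 statements merged into one kernel-verified Lean document; each statement's English description precedes it below -/
import Mathlib

section
/- For every integer t ≥ 1 and every integer n, φ_t(n) = (⌊min{n, 2t−2−n}/2⌋ + 1)_+, where ⌊·/2⌋ denotes integer floor division by 2. -/
open MvPolynomial Module

noncomputable section

/-- The recursively defined function `φ_t(n)` (natural index). -/
def phiNat : ℕ → ℤ → ℤ
  | 0, _ => 0
  | 1, n => if n = 0 then 1 else 0
  | (t+2), n =>
    if 0 ≤ n ∧ n < (t : ℤ) + 1 then phiNat (t+1) n
    else if (t : ℤ) + 1 ≤ n ∧ n < 2 * ((t : ℤ) + 1) + 1 then phiNat (t+1) n + 1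
    else 0

/-- `φ_t : ℤ → ℤ`, identically `0` for `t ≤ 0`. -/
def phi (t n : ℤ) : ℤ := if 0 < t then phiNat t.toNat n else 0

/-- `φ_{t,d}(n) = φ_t(n+d) − φ_d(n+d)`. -/
def phi2 (t d n : ℤ) : ℤ := phi t (n + d) - phi d (n + d)

/-- `(n)_+ = max{n, 0}`. -/
def pos (n : ℤ) : ℤ := max n 0

variable (k : Type*) [Field k] [CharZero k]

/-- The bigrading weights on `k[x₀,x₁,x₂,x₃]`. -/
def w : Fin 4 → ℕ × ℕ := ![(1,0), (1,0), (0,1), (0,1)]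

/-- The bihomogeneous component `R_{(a,b)}` as a `k`-subspace. -/
def comp (a b : ℕ) : Submodule k (MvPolynomial (Fin 4) k) :=
  weightedHomogeneousSubmodule k w (a, b)

/-- The irrelevant ideal `𝔪 = (x₀,x₁,x₂,x₃)`. -/
def mIdeal : Ideal (MvPolynomial (Fin 4) k) :=
  Ideal.span {X 0, X 1, X 2, X 3}

/-- `β_{0,(a,b)}(I) = dim_k (I ∩ R_{(a,b)}) − dim_k ((𝔪·I) ∩ R_{(a,b)})`. -/
def beta0 (I : Ideal (MvPolynomial (Fin 4) k)) (a b : ℕ) : ℤ :=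
  (finrank k ↥(I.restrictScalars k ⊓ comp k a b) : ℤ)
    - (finrank k ↥((mIdeal k * I).restrictScalars k ⊓ comp k a b) : ℤ)

/-- The Hilbert function `H(a,b) = (a+1)(b+1) − dim_k (I ∩ R_{(a,b)})`, `0` off `ℕ²`. -/
def HF (I : Ideal (MvPolynomial (Fin 4) k)) (a b : ℤ) : ℤ :=
  if 0 ≤ a ∧ 0 ≤ b then
    (a + 1) * (b + 1) - (finrank k ↥(I.restrictScalars k ⊓ comp k a.toNat b.toNat) : ℤ)
  else 0

/-- The first difference `ΔH(a,b)`. -/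
def dHF (I : Ideal (MvPolynomial (Fin 4) k)) (a b : ℤ) : ℤ :=
  HF k I a b + HF k I (a-1) (b-1) - HF k I (a-1) b - HF k I a (b-1)

def I11 : Ideal (MvPolynomial (Fin 4) k) := Ideal.span {X 0, X 2}
def I12 : Ideal (MvPolynomial (Fin 4) k) := Ideal.span {X 0, X 3}
def I21 : Ideal (MvPolynomial (Fin 4) k) := Ideal.span {X 1, X 2}

/-- The ideal of `Z = m₁₁P₁₁ + m₁₂P₁₂ + m₂₁P₂₁`. -/
def IZ (m11 m12 m21 : ℕ) : Ideal (MvPolynomial (Fin 4) k) :=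
  I11 k ^ m11 ⊓ I12 k ^ m12 ⊓ I21 k ^ m21

/-- `max{m₁₁, m₁₂ + m₂₁}`. -/
def Dbound (m11 m12 m21 : ℕ) : ℤ := max (m11 : ℤ) ((m12 : ℤ) + m21)

def D1set (m11 m12 m21 : ℕ) : Set (ℕ × ℕ) :=
  {p | (p.2 : ℤ) < pos (-((m12 : ℤ) - m11)) - pos (-((m12 : ℤ) - m11) - m21) ∧
       (p.1 : ℤ) + 2 * p.2 = (m11 : ℤ) + m21}

def D2set (m11 m12 m21 : ℕ) : Set (ℕ × ℕ) :=
  {p | pos (-((m12 : ℤ) - m11)) - pos (-((m12 : ℤ) - m11) - m21) ≤ (p.2 : ℤ) ∧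
       (p.2 : ℤ) < m21 ∧ (p.1 : ℤ) + p.2 = Dbound m11 m12 m21}

def D3set (m11 m12 m21 : ℕ) : Set (ℕ × ℕ) :=
  {p | (m21 : ℤ) ≤ p.2 ∧ (p.2 : ℤ) ≤ m21 + |((m12 : ℤ) - m11) + m21| ∧
       (p.1 : ℤ) + p.2 = Dbound m11 m12 m21}

def D4set (m11 m12 m21 : ℕ) : Set (ℕ × ℕ) :=
  {p | (m21 : ℤ) + |((m12 : ℤ) - m11) + m21| < (p.2 : ℤ) ∧
       2 * (p.1 : ℤ) + p.2 = (m11 : ℤ) + m12}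


theorem phiNat_succ_eq (t : ℕ) (n : ℤ) :
    phiNat (t + 1) n = max (min n (2 * t - n) / 2 + 1) 0 := by
  induction t with
  | zero =>
    simp only [phiNat]
    split_ifs <;> omega
  | succ t ih =>
    simp only [phiNat, ih]
    push_cast
    split_ifs <;> omega

/-- For every `t ≥ 1` and every `n`,
`φ_t(n) = (⌊min{n, 2t−2−n}/2⌋ + 1)_+` (floor division). -/
theorem phi_closed_formula (t : ℤ) (ht : 1 ≤ t) (n : ℤ) :
    phi t n = pos (Int.fdiv (min n (2 * t - 2 - n)) 2 + 1) := by
  obtain ⟨m, rfl⟩ : ∃ m : ℕ, t = m + 1 := ⟨(t - 1).toNat, by omega⟩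
  have h_index : ((m : ℤ) + 1).toNat = m + 1 := by omega
  rw [phi, if_pos (by omega), h_index, phiNat_succ_eq, pos,
    Int.fdiv_eq_ediv_of_nonneg _ (by norm_num)]
  congr 5
  ring

end
end

section
/- Let t ≥ d be integers. For every integer n: if 0 ≤ n ≤ d then φ_{t,d+1}(n−1) = φ_{t,d}(n) − 1, and otherwise φ_{t,d+1}(n−1) = φ_{t,d}(n). -/
open MvPolynomial Module

noncomputable section

variable (k : Type*) [Field k] [CharZero k]

theorem phiNat_eq_zero_of_notMem (t : ℕ) (n : ℤ) (h : ¬(0 ≤ n ∧ n < 2 * (t : ℤ) - 1)) :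
    phiNat t n = 0 := by
  match t with
  | 0 => rfl
  | 1 =>
    rw [phiNat, if_neg]
    omega
  | t + 2 =>
    push_cast at h
    rw [phiNat, if_neg (by omega), if_neg (by omega)]

theorem phiNat_succ (t : ℕ) (n : ℤ) :
    phiNat (t + 1) n = phiNat t n + if (t : ℤ) ≤ n ∧ n ≤ 2 * t then 1 else 0 := by
  match t with
  | 0 =>
    simp only [phiNat, Nat.cast_zero]
    split_ifs <;> omega
  | t + 1 =>
    have hzero := phiNat_eq_zero_of_notMem (t + 1) n
    rw [phiNat]
    push_cast at hzero ⊢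
    split_ifs <;> omega

theorem phi_add_one (t n : ℤ) :
    phi (t + 1) n = phi t n + if t ≤ n ∧ n ≤ 2 * t then 1 else 0 := by
  rcases lt_or_ge t 0 with ht | ht
  · rw [phi, phi, if_neg (by omega), if_neg (by omega), if_neg (by omega), add_zero]
  · lift t to ℕ using ht
    have hphi (s : ℕ) : phi s n = phiNat s n := by
      cases s with
      | zero => rfl
      | succ s => rw [phi, if_pos (by omega), Int.toNat_natCast]
    rw [hphi t, ← Nat.cast_succ, hphi, phiNat_succ]

/-- Proposition 3.4: for `t ≥ d`, `φ_{t,d+1}(n−1) = φ_{t,d}(n) − 1` if `0 ≤ n ≤ d`,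
and `φ_{t,d+1}(n−1) = φ_{t,d}(n)` otherwise. -/
theorem phi2_rec (t d : ℤ) (htd : d ≤ t) (n : ℤ) :
    (0 ≤ n ∧ n ≤ d → phi2 t (d + 1) (n - 1) = phi2 t d n - 1) ∧
    (¬(0 ≤ n ∧ n ≤ d) → phi2 t (d + 1) (n - 1) = phi2 t d n) := by
  have h := phi_add_one d (n + d)
  have hshift : n - 1 + (d + 1) = n + d := by ring
  simp only [phi2, hshift, h]
  split_ifs <;> omega

end
end

section
/- Let m_11, m_12 be nonnegative integers, not both zero, let I_Z = (x_0,x_2)^{m_11} ∩ (x_0,x_3)^{m_12} be the ideal of the two collinear fat points Z = m_11 P_11 + m_12 P_12, and set M = max{m_11, m_12}. Then for every (a,b) ∈ ℕ², β_0,(a,b)(I_Z) = 1 if (a,b) = (t, (m_11−t)_+ + (m_12−t)_+) for some integer t with 0 ≤ t ≤ M, and β_0,(a,b)(I_Z) = 0 otherwise. -/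
open MvPolynomial Module

noncomputable section

variable (k : Type*) [Field k] [CharZero k]

section SupportIdeals

variable {σ R : Type*} [CommSemiring R]

/-- If all exponents of `p` lie in `s`, and the ideal `I` contains every monomial with exponent
in `s`, then `p ∈ I`. -/
theorem mem_ideal_of_support_subset {I : Ideal (MvPolynomial σ R)} {s : Set (σ →₀ ℕ)}
    (h : ∀ e ∈ s, monomial e (1 : R) ∈ I) {p : MvPolynomial σ R}
    (hp : ∀ e ∈ p.support, e ∈ s) : p ∈ I := by
  rw [p.as_sum]
  refine I.sum_mem fun e he => ?_
  have := I.mul_mem_left (C (p.coeff e)) (h e (hp e he))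
  rwa [C_mul_monomial, mul_one] at this

/-- A product of polynomials supported on `s` and `t` is supported on any set containing
`s + t`. -/
theorem mul_support_subset {s t u : Set (σ →₀ ℕ)} (h : ∀ x ∈ s, ∀ y ∈ t, x + y ∈ u)
    {p q : MvPolynomial σ R} (hp : ∀ e ∈ p.support, e ∈ s) (hq : ∀ e ∈ q.support, e ∈ t) :
    ∀ e ∈ (p * q).support, e ∈ u := by
  classical
  intro e he
  obtain ⟨x, hx, y, hy, rfl⟩ := Finset.mem_add.mp (support_mul p q he)
  exact h x (hp x hx) y (hq y hy)

/-- The ideal generated by a set of variables consists of the polynomials each of whose monomials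
involves one of these variables. -/
theorem mem_span_X_image {v : Set σ} {p : MvPolynomial σ R} :
    p ∈ Ideal.span (X '' v) ↔ ∀ e ∈ p.support, ∃ i ∈ v, e i ≠ 0 :=
  mem_ideal_span_X_image

/-- Membership in a power of an ideal generated by two variables. -/
theorem mem_span_pair_X_pow {i j : σ} (hij : i ≠ j) (m : ℕ) {p : MvPolynomial σ R} :
    p ∈ Ideal.span {X i, X j} ^ m ↔ ∀ e ∈ p.support, m ≤ e i + e j := by
  constructor
  · induction m generalizing p with
    | zero => simp
    | succ m ih =>
      intro hp
      rw [pow_succ] at hp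
      refine Submodule.mul_induction_on hp (fun q hq r hr => ?_) fun q r hq hr e he => ?_
      · refine mul_support_subset (s := {e | m ≤ e i + e j}) (t := {e | 1 ≤ e i + e j})
          (u := {e | m + 1 ≤ e i + e j}) ?_ (ih hq) ?_
        · intro x hx y hy
          simp only [Set.mem_ofPred_eq, Finsupp.add_apply] at *
          omega
        · rw [← Set.image_pair, mem_span_X_image] at hr
          intro e he
          have := hr e he
          simp only [Set.mem_insert_iff, Set.mem_singleton_iff, exists_eq_or_imp,
            exists_eq_left] at this
          simp only [Set.mem_ofPred_eq]
          omega
      · classical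
        rcases Finset.mem_union.mp (support_add he) with h | h
        exacts [hq e h, hr e h]
  · refine fun hp => mem_ideal_of_support_subset (s := {e | m ≤ e i + e j}) (fun e he => ?_) hp
    have hle : Finsupp.single i (e i) + Finsupp.single j (e j) ≤ e := by
      classical
      intro l
      simp only [Finsupp.add_apply, Finsupp.single_apply]
      split_ifs with h₁ h₂ h₂
      · exact absurd (h₁.trans h₂.symm) hij
      all_goals subst_vars; simp
    obtain ⟨c, hc⟩ := le_iff_exists_add'.mp hle
    have hfac : monomial e (1 : R) = monomial c 1 * (X i ^ e i * X j ^ e j) := by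
      rw [X_pow_eq_monomial, X_pow_eq_monomial, monomial_mul, monomial_mul, one_mul, one_mul]
      exact congrArg (fun d => monomial d (1 : R)) hc
    rw [hfac]
    refine Ideal.mul_mem_left _ _ (Ideal.pow_le_pow_right he ?_)
    rw [pow_add]
    exact Ideal.mul_mem_mul
      (Ideal.pow_mem_pow (Ideal.subset_span (by simp)) _)
      (Ideal.pow_mem_pow (Ideal.subset_span (by simp)) _)

/-- If `I` is the ideal of polynomials supported on `s`, then the product of `I` with the ideal of
all variables is the ideal of polynomials all of whose exponents are obtained from `s` by
incrementing one coordinate. -/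
theorem mem_span_range_X_mul {I : Ideal (MvPolynomial σ R)} {s : Set (σ →₀ ℕ)}
    (h : ∀ p, p ∈ I ↔ ∀ e ∈ p.support, e ∈ s) [Nontrivial R] {p : MvPolynomial σ R} :
    p ∈ Ideal.span (Set.range X) * I ↔
      ∀ e ∈ p.support, ∃ i, ∃ d ∈ s, e = d + Finsupp.single i 1 := by
  have hup : ∀ d ∈ s, ∀ c, c + d ∈ s := by
    intro d hd c
    have hd' : monomial d (1 : R) ∈ I := (h _).2 fun e he => by
      rwa [Finset.mem_singleton.mp (support_monomial_subset he)]
    have := I.mul_mem_left (monomial c 1) hd'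
    rw [monomial_mul, mul_one] at this
    exact (h _).1 this _ (by classical simp [MvPolynomial.mem_support_iff, coeff_monomial])
  constructor
  · intro hp
    refine Submodule.mul_induction_on hp (fun q hq r hr => ?_) fun q r hq hr e he => ?_
    · refine mul_support_subset (s := {e | ∃ i ∈ Set.univ, e i ≠ 0}) (t := s)
        (u := {e | ∃ i, ∃ d ∈ s, e = d + Finsupp.single i 1}) ?_ ?_ ((h r).1 hr)
      · rintro x ⟨i, -, hi⟩ y hy
        obtain ⟨c, rfl⟩ := le_iff_exists_add'.mp
          (Finsupp.single_le_iff.mpr (Nat.one_le_iff_ne_zero.mpr hi))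
        exact ⟨i, c + y, hup y hy c, by abel⟩
      · rwa [← Set.image_univ, mem_span_X_image] at hq
    · classical
      rcases Finset.mem_union.mp (support_add he) with h | h
      exacts [hq e h, hr e h]
  · refine fun hp => mem_ideal_of_support_subset
      (s := {e | ∃ i, ∃ d ∈ s, e = d + Finsupp.single i 1}) ?_ hp
    rintro _ ⟨i, d, hd, rfl⟩
    have hd' : monomial d (1 : R) ∈ I := (h _).2 fun e he => by
      rwa [Finset.mem_singleton.mp (support_monomial_subset he)]
    have := Ideal.mul_mem_mul (Ideal.subset_span (Set.mem_range_self (f := X (R := R)) i)) hd'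
    rwa [X, monomial_mul, mul_one, add_comm] at this

end SupportIdeals

/-- The exponents of the monomials of bidegree `(a, b)`. -/
def bidegreeExponents (a b : ℕ) : Set (Fin 4 →₀ ℕ) := {e | e 0 + e 1 = a ∧ e 2 + e 3 = b}

theorem finite_bidegreeExponents (a b : ℕ) : (bidegreeExponents a b).Finite := by
  refine (Set.finite_Iic (Finsupp.equivFunOnFinite.symm fun _ : Fin 4 => a + b)).subset ?_
  rintro e ⟨h₁, h₂⟩ i
  fin_cases i <;> simp <;> omega

theorem weight_w_eq_iff (e : Fin 4 →₀ ℕ) (a b : ℕ) :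
    Finsupp.weight w e = (a, b) ↔ e ∈ bidegreeExponents a b := by
  rw [Finsupp.weight_apply, Finsupp.sum_fintype _ _ (by simp)]
  simp [Fin.sum_univ_four, w, bidegreeExponents, -smul_eq_mul, Prod.ext_iff]

section TwoFatPoints

variable {F : Type*} [Field F]

theorem finrank_inf_comp {I : Ideal (MvPolynomial (Fin 4) F)} {s : Set (Fin 4 →₀ ℕ)}
    (h : ∀ p, p ∈ I ↔ ∀ e ∈ p.support, e ∈ s) (a b : ℕ) :
    finrank F ↥(I.restrictScalars F ⊓ comp F a b) = (s ∩ bidegreeExponents a b).ncard := by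
  have : I.restrictScalars F ⊓ comp F a b = restrictSupport F (s ∩ bidegreeExponents a b) := by
    ext p
    rw [mem_restrictSupport_iff, Submodule.mem_inf, Submodule.restrictScalars_mem, h, comp,
      mem_weightedHomogeneousSubmodule, Set.subset_inter_iff]
    refine and_congr Iff.rfl ?_
    simp only [IsWeightedHomogeneous, weight_w_eq_iff, Set.subset_def, Finset.mem_coe,
      MvPolynomial.mem_support_iff]
  rw [this, finrank_eq_nat_card_basis (basisRestrictSupport F _), Nat.card_coe_set_eq]

theorem mIdeal_eq_span_range : mIdeal F = Ideal.span (Set.range X) := by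
  rw [mIdeal]
  congr 1
  ext p
  simp [Fin.exists_fin_succ, eq_comm]

/-- `β₀` of a monomial ideal counts the exponents which are minimal in the ideal. -/
theorem beta0_eq_ncard {I : Ideal (MvPolynomial (Fin 4) F)} {s : Set (Fin 4 →₀ ℕ)}
    (h : ∀ p, p ∈ I ↔ ∀ e ∈ p.support, e ∈ s) (a b : ℕ) :
    beta0 F I a b =
      ({e ∈ s | ∀ i, ∀ d ∈ s, e ≠ d + Finsupp.single i 1} ∩ bidegreeExponents a b).ncard := by
  set t : Set (Fin 4 →₀ ℕ) := {e | ∃ i, ∃ d ∈ s, e = d + Finsupp.single i 1} with ht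
  have hmI : ∀ p, p ∈ mIdeal F * I ↔ ∀ e ∈ p.support, e ∈ t := fun p => by
    rw [mIdeal_eq_span_range, mem_span_range_X_mul h]
    rfl
  have hts : t ⊆ s := by
    intro e he
    have hmem : monomial e (1 : F) ∈ mIdeal F * I := (hmI _).2 fun d hd => by
      rwa [Finset.mem_singleton.mp (support_monomial_subset hd)]
    have hI : monomial e (1 : F) ∈ I := Ideal.mul_le_right hmem
    exact (h _).1 hI e (by classical simp [MvPolynomial.mem_support_iff, coeff_monomial])
  have hdiff : {e ∈ s | ∀ i, ∀ d ∈ s, e ≠ d + Finsupp.single i 1} ∩ bidegreeExponents a b =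
      (s ∩ bidegreeExponents a b) \ (t ∩ bidegreeExponents a b) := by
    ext e
    have het : (∀ i, ∀ d ∈ s, e ≠ d + Finsupp.single i 1) ↔ e ∉ t := by
      simp only [ht, Set.mem_ofPred_eq]
      push Not
      rfl
    simp only [Set.mem_inter_iff, Set.mem_sdiff, Set.mem_ofPred_eq, het]
    tauto
  have hcard := Set.ncard_sdiff_add_ncard_of_subset
    (Set.inter_subset_inter_left (bidegreeExponents a b) hts)
    ((finite_bidegreeExponents a b).inter_of_right s)
  rw [beta0, finrank_inf_comp h, finrank_inf_comp hmI, hdiff]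
  omega

/-- The exponents of the monomials in `(x₀,x₂)^m ∩ (x₀,x₃)^n`. -/
def twoPointExponents (m n : ℕ) : Set (Fin 4 →₀ ℕ) := {e | m ≤ e 0 + e 2 ∧ n ≤ e 0 + e 3}

theorem mem_two_fat_points {m n : ℕ} (p : MvPolynomial (Fin 4) F) :
    p ∈ I11 F ^ m ⊓ I12 F ^ n ↔ ∀ e ∈ p.support, e ∈ twoPointExponents m n := by
  rw [Ideal.mem_inf, I11, I12, mem_span_pair_X_pow (by decide), mem_span_pair_X_pow (by decide),
    ← forall₂_and]
  rfl

theorem minimal_twoPointExponents_iff {m n : ℕ} (e : Fin 4 →₀ ℕ) :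
    (e ∈ twoPointExponents m n ∧
        ∀ i, ∀ d ∈ twoPointExponents m n, e ≠ d + Finsupp.single i 1) ↔
      e 0 ≤ max m n ∧ e 1 = 0 ∧ e 2 = m - e 0 ∧ e 3 = n - e 0 := by
  constructor
  · rintro ⟨⟨h₁, h₂⟩, h⟩
    have key : ∀ i, e i ≠ 0 → e - Finsupp.single i 1 ∉ twoPointExponents m n := fun i hi hd =>
      h i _ hd (tsub_add_cancel_of_le
        (Finsupp.single_le_iff.mpr (Nat.one_le_iff_ne_zero.mpr hi))).symm
    have k₀ := key 0
    have k₁ := key 1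
    have k₂ := key 2
    have k₃ := key 3
    simp [twoPointExponents] at k₀ k₁ k₂ k₃
    omega
  · rintro ⟨h₀, h₁, h₂, h₃⟩
    refine ⟨⟨by omega, by omega⟩, ?_⟩
    rintro i d ⟨hd₁, hd₂⟩ rfl
    fin_cases i <;> simp at h₀ h₁ h₂ h₃ <;> omega

end TwoFatPoints


/-- Lemma 2.2: the minimal generators of the ideal of two collinear fat points
`Z = m₁₁P₁₁ + m₁₂P₁₂` occur exactly in the bidegrees `(t, (m₁₁−t)_+ + (m₁₂−t)_+)`
for `0 ≤ t ≤ M = max{m₁₁, m₁₂}`, each with multiplicity one. -/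
theorem beta0_two_collinear_fat_points (m11 m12 : ℕ) (hm : ¬(m11 = 0 ∧ m12 = 0)) (a b : ℕ) :
    ((∃ t : ℤ, 0 ≤ t ∧ t ≤ max (m11 : ℤ) (m12 : ℤ) ∧ (a : ℤ) = t ∧
        (b : ℤ) = pos ((m11 : ℤ) - t) + pos ((m12 : ℤ) - t)) →
      beta0 k (I11 k ^ m11 ⊓ I12 k ^ m12) a b = 1) ∧
    (¬(∃ t : ℤ, 0 ≤ t ∧ t ≤ max (m11 : ℤ) (m12 : ℤ) ∧ (a : ℤ) = t ∧
        (b : ℤ) = pos ((m11 : ℤ) - t) + pos ((m12 : ℤ) - t)) →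
      beta0 k (I11 k ^ m11 ⊓ I12 k ^ m12) a b = 0) := by
  rw [beta0_eq_ncard mem_two_fat_points a b]
  simp only [minimal_twoPointExponents_iff]
  constructor
  · rintro ⟨t, -, htM, rfl, hb⟩
    simp only [pos] at hb
    rw [Nat.cast_eq_one, Set.ncard_eq_one]
    refine ⟨Finsupp.equivFunOnFinite.symm ![a, 0, m11 - a, m12 - a], ?_⟩
    ext e
    simp only [Set.mem_inter_iff, Set.mem_ofPred_eq, bidegreeExponents, Set.mem_singleton_iff,
      DFunLike.ext_iff, Fin.forall_fin_succ, Finsupp.equivFunOnFinite_symm_apply_apply]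
    simp
    omega
  · intro hab
    rw [Nat.cast_eq_zero, Set.ncard_eq_zero ((finite_bidegreeExponents a b).inter_of_right _),
      Set.eq_empty_iff_forall_notMem]
    rintro e ⟨⟨h₀, h₁, h₂, h₃⟩, h₄, h₅⟩
    refine hab ⟨a, by omega, by omega, rfl, ?_⟩
    simp only [pos]
    omega

end
end

section
/- Let m_12, m_21 be nonnegative integers and let I_Z = (x_0,x_3)^{m_12} ∩ (x_1,x_2)^{m_21} be the ideal of the two non-collinear fat points Z = m_12 P_12 + m_21 P_21. Then for every (i,j) ∈ ℕ², β_0,(i,j)(I_Z) equals the number of quadruples (a,b,c,d) ∈ ℕ⁴ with a + d = m_12, b + c = m_21, a + b = i and c + d = j. -/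
open MvPolynomial Module

noncomputable section

variable (k : Type*) [Field k] [CharZero k]

theorem restrictSupportIdeal_le_iff {σ R : Type*} [CommSemiring R] {S : Set (σ →₀ ℕ)}
    {hS : IsUpperSet S} {J : Ideal (MvPolynomial σ R)} :
    restrictSupportIdeal R S hS ≤ J ↔ ∀ s ∈ S, monomial s (1 : R) ∈ J := by
  change restrictSupport R S ≤ J.restrictScalars R ↔ _
  rw [restrictSupport_eq_span, Submodule.span_le, Set.image_subset_iff]
  rfl

theorem mem_restrictSupportIdeal_iff {σ R : Type*} [CommSemiring R] {S : Set (σ →₀ ℕ)}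
    {hS : IsUpperSet S} {p : MvPolynomial σ R} :
    p ∈ restrictSupportIdeal R S hS ↔ ∀ s ∈ p.support, s ∈ S :=
  Iff.rfl

theorem isUpperSet_le_add {σ : Type*} (a b : σ) (m : ℕ) :
    IsUpperSet {s : σ →₀ ℕ | m ≤ s a + s b} :=
  fun _ _ hst hs => hs.trans (Nat.add_le_add (hst a) (hst b))

theorem isUpperSet_exists_lt {α : Type*} [Preorder α] (S : Set α) :
    IsUpperSet {s : α | ∃ t ∈ S, t < s} :=
  fun _ _ hst ⟨u, hu, h⟩ => ⟨u, hu, h.trans_le hst⟩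

theorem mul_X_mem_restrictSupportIdeal {σ R : Type*} [CommSemiring R] {S T : Set (σ →₀ ℕ)}
    {hS : IsUpperSet S} {hT : IsUpperSet T} {l : σ}
    (h : ∀ s ∈ S, s + Finsupp.single l 1 ∈ T) {p : MvPolynomial σ R}
    (hp : p ∈ restrictSupportIdeal R S hS) : p * X l ∈ restrictSupportIdeal R T hT := by
  rw [mem_restrictSupportIdeal_iff] at hp ⊢
  intro s hs
  rw [support_mul_X, Finset.mem_map] at hs
  obtain ⟨t, ht, rfl⟩ := hs
  exact h t (hp t ht)

/-- The powers of an ideal generated by two distinct variables are monomial ideals. -/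
theorem span_X_pair_pow {σ R : Type*} [CommSemiring R] {a b : σ} (hab : a ≠ b) (m : ℕ) :
    (Ideal.span {X a, X b} : Ideal (MvPolynomial σ R)) ^ m =
      restrictSupportIdeal R {s | m ≤ s a + s b} (isUpperSet_le_add a b m) := by
  apply le_antisymm
  · induction m with
    | zero => exact fun p _ => mem_restrictSupportIdeal_iff.2 fun s _ => Nat.zero_le _
    | succ m ih =>
      rw [pow_succ, Ideal.mul_le]
      intro p hp q hq
      obtain ⟨u, v, rfl⟩ := Ideal.mem_span_pair.1 hq
      have hp := ih hp
      rw [mul_add, mul_left_comm, mul_left_comm p]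
      refine add_mem (Ideal.mul_mem_left _ _ (mul_X_mem_restrictSupportIdeal ?_ hp))
        (Ideal.mul_mem_left _ _ (mul_X_mem_restrictSupportIdeal ?_ hp))
      · intro s hs
        simp only [Set.mem_ofPred_eq, Finsupp.add_apply, Finsupp.single_eq_same] at hs ⊢
        lia
      · intro s hs
        simp only [Set.mem_ofPred_eq, Finsupp.add_apply, Finsupp.single_eq_same] at hs ⊢
        lia
  · rw [restrictSupportIdeal_le_iff]
    intro s hs
    refine Ideal.pow_le_pow_right hs ?_
    have hle : Finsupp.single a (s a) + Finsupp.single b (s b) ≤ s := by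
      intro c
      classical
      simp only [Finsupp.add_apply, Finsupp.single_apply]
      grind
    obtain ⟨t, ht⟩ := exists_add_of_le hle
    have hmon : monomial s (1 : R) = X a ^ s a * X b ^ s b * monomial t 1 := by
      conv_lhs => rw [ht]
      simp [X_pow_eq_monomial, monomial_mul]
    rw [hmon, pow_add]
    exact Ideal.mul_mem_right _ _ (Ideal.mul_mem_mul
      (Ideal.pow_mem_pow (Ideal.subset_span (by simp)) _)
      (Ideal.pow_mem_pow (Ideal.subset_span (by simp)) _))

/-- Multiplying a monomial ideal by the irrelevant ideal removes exactly its minimal monomials. -/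
theorem idealOfVars_mul_restrictSupportIdeal {σ R : Type*} [CommSemiring R]
    {S : Set (σ →₀ ℕ)} (hS : IsUpperSet S) :
    idealOfVars σ R * restrictSupportIdeal R S hS =
      restrictSupportIdeal R {s | ∃ t ∈ S, t < s} (isUpperSet_exists_lt S) := by
  apply le_antisymm
  · rw [Ideal.mul_le]
    intro p hp q hq
    refine Submodule.span_induction ?_ ?_ ?_ ?_ hp
    · rintro _ ⟨l, rfl⟩
      rw [mul_comm]
      refine mul_X_mem_restrictSupportIdeal (S := S) (fun s hs => ?_) hq
      exact ⟨s, hs, lt_add_of_pos_right _ (by simp [pos_iff_ne_zero])⟩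
    · simp
    · intro x y _ _ hx hy
      rw [add_mul]
      exact add_mem hx hy
    · intro r x _ hx
      rw [smul_eq_mul, mul_assoc]
      exact Ideal.mul_mem_left _ _ hx
  · rw [restrictSupportIdeal_le_iff]
    rintro s ⟨t, ht, hts⟩
    obtain ⟨l, hl⟩ := (Finsupp.lt_def.1 hts).2
    have hle : t + Finsupp.single l 1 ≤ s := by
      intro c
      classical
      have := hts.le c
      simp only [Finsupp.add_apply, Finsupp.single_apply]
      grind
    obtain ⟨u, rfl⟩ := exists_add_of_le hle
    have hmon : monomial (t + Finsupp.single l 1 + u) (1 : R) = X l * monomial (t + u) 1 := by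
      rw [X, monomial_mul, one_mul, ← add_assoc, add_comm t]
    rw [hmon]
    refine Ideal.mul_mem_mul (Ideal.subset_span ⟨l, rfl⟩) (mem_restrictSupportIdeal_iff.2 ?_)
    intro v hv
    rw [Finset.mem_singleton.1 (support_monomial_subset hv)]
    exact hS le_self_add ht

theorem finrank_restrictSupport {σ R : Type*} [CommRing R] [Nontrivial R]
    (S : Set (σ →₀ ℕ)) : finrank R (restrictSupport R S) = S.ncard := by
  rw [finrank_eq_nat_card_basis (basisRestrictSupport R S), Nat.card_coe_set_eq]

theorem mIdeal_eq_idealOfVars {k : Type*} [Field k] [CharZero k] :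
    mIdeal k = idealOfVars (Fin 4) k := by
  rw [mIdeal, idealOfVars]
  congr 1
  ext p
  simp [Fin.exists_fin_succ, eq_comm]

theorem weight_w_eq_iff_s3 (s : Fin 4 →₀ ℕ) (i j : ℕ) :
    Finsupp.weight w s = (i, j) ↔ s 0 + s 1 = i ∧ s 2 + s 3 = j := by
  rw [Finsupp.weight_apply, s.sum_fintype (fun i c => c • w i) fun _ => zero_smul _ _]
  simp [Fin.sum_univ_four, w, -nsmul_eq_mul]

theorem finrank_restrictSupportIdeal_inf_comp {k : Type*} [Field k] [CharZero k]
    (S : Set (Fin 4 →₀ ℕ)) (hS : IsUpperSet S) (i j : ℕ) :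
    finrank k ↥((restrictSupportIdeal k S hS).restrictScalars k ⊓
      comp k i j) = (S ∩ {s | s 0 + s 1 = i ∧ s 2 + s 3 = j}).ncard := by
  have h : (restrictSupportIdeal k S hS).restrictScalars k ⊓ comp k i j =
      restrictSupport k (S ∩ {s | s 0 + s 1 = i ∧ s 2 + s 3 = j}) := by
    ext p
    simp only [comp, weightedHomogeneousSubmodule_eq_finsupp_supported, weight_w_eq_iff_s3]
    exact Set.subset_inter_iff.symm
  rw [h, finrank_restrictSupport]

theorem finite_setOf_bidegree_eq (i j : ℕ) :
    {s : Fin 4 →₀ ℕ | s 0 + s 1 = i ∧ s 2 + s 3 = j}.Finite := by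
  refine (Set.finite_Iic (Finsupp.equivFunOnFinite.symm fun _ : Fin 4 => i + j)).subset ?_
  rintro s ⟨h₁, h₂⟩ c
  fin_cases c <;> simp <;> lia

/-- If `I` is a monomial ideal, `β_{0,(i,j)}(I)` counts its minimal monomials of bidegree
`(i, j)`. -/
theorem beta0_restrictSupportIdeal {k : Type*} [Field k] [CharZero k]
    (S : Set (Fin 4 →₀ ℕ)) (hS : IsUpperSet S) (i j : ℕ) :
    beta0 k (restrictSupportIdeal k S hS) i j =
      ({s | Minimal (· ∈ S) s ∧ s 0 + s 1 = i ∧ s 2 + s 3 = j}.ncard : ℤ) := by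
  rw [beta0, mIdeal_eq_idealOfVars, idealOfVars_mul_restrictSupportIdeal,
    finrank_restrictSupportIdeal_inf_comp, finrank_restrictSupportIdeal_inf_comp, sub_eq_iff_eq_add]
  have hsub : {s | ∃ t ∈ S, t < s} ∩ {s : Fin 4 →₀ ℕ | s 0 + s 1 = i ∧ s 2 + s 3 = j} ⊆
      S ∩ {s | s 0 + s 1 = i ∧ s 2 + s 3 = j} :=
    Set.inter_subset_inter_left _ fun s ⟨t, ht, hts⟩ => hS hts.le ht
  rw [← Set.ncard_sdiff_add_ncard_of_subset hsub
    ((finite_setOf_bidegree_eq i j).subset Set.inter_subset_right), Nat.cast_add]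
  congr 3
  ext s
  simp only [Set.mem_sdiff, Set.mem_inter_iff, Set.mem_ofPred_eq, minimal_iff_forall_lt]
  grind

theorem minimal_le_add_and_le_add_iff {m n : ℕ} {s : Fin 4 →₀ ℕ} :
    Minimal (· ∈ {s : Fin 4 →₀ ℕ | m ≤ s 0 + s 3} ∩ {s | n ≤ s 1 + s 2}) s ↔
      s 0 + s 3 = m ∧ s 1 + s 2 = n := by
  constructor
  · rintro ⟨⟨h₁, h₂⟩, hmin⟩
    simp only [Set.mem_ofPred_eq] at h₁ h₂
    have key (l : Fin 4) (hl : s l ≠ 0)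
        (h : s - Finsupp.single l 1 ∈
          {s : Fin 4 →₀ ℕ | m ≤ s 0 + s 3} ∩ {s | n ≤ s 1 + s 2}) : False := by
      have := hmin h tsub_le_self l
      simp at this
      lia
    have k0 := key 0
    have k1 := key 1
    have k2 := key 2
    have k3 := key 3
    simp at k0 k1 k2 k3
    lia
  · rintro ⟨h₁, h₂⟩
    refine ⟨⟨h₁.ge, h₂.ge⟩, ?_⟩
    rintro t ⟨ht₁, ht₂⟩ hts c
    simp only [Set.mem_ofPred_eq] at ht₁ ht₂
    have := hts 0
    have := hts 1
    have := hts 2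
    have := hts 3
    fin_cases c <;> simp <;> lia

/-- Lemma 3.4: for the two non-collinear fat points `Z = m₁₂P₁₂ + m₂₁P₂₁`,
`β_{0,(i,j)}(I_Z)` is the number of quadruples `(a,b,c,d) ∈ ℕ⁴` with
`a + d = m₁₂`, `b + c = m₂₁`, `a + b = i` and `c + d = j`. -/
theorem beta0_two_noncollinear_fat_points (m12 m21 : ℕ) (i j : ℕ) :
    beta0 k (I12 k ^ m12 ⊓ I21 k ^ m21) i j =
      (Set.ncard {q : ℕ × ℕ × ℕ × ℕ |
        q.1 + q.2.2.2 = m12 ∧ q.2.1 + q.2.2.1 = m21 ∧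
        q.1 + q.2.1 = i ∧ q.2.2.1 + q.2.2.2 = j} : ℤ) := by
  have hI : I12 k ^ m12 ⊓ I21 k ^ m21 = restrictSupportIdeal k
      ({s | m12 ≤ s 0 + s 3} ∩ {s | m21 ≤ s 1 + s 2})
      ((isUpperSet_le_add 0 3 m12).inter (isUpperSet_le_add 1 2 m21)) := by
    rw [I12, I21, span_X_pair_pow (by decide), span_X_pair_pow (by decide)]
    ext p
    exact Set.subset_inter_iff.symm
  rw [hI, beta0_restrictSupportIdeal]
  simp only [minimal_le_add_and_le_add_iff]
  congr 1
  refine Set.ncard_congr (fun s _ => (s 0, s 1, s 2, s 3)) ?_ ?_ ?_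
  · rintro s ⟨⟨h₁, h₂⟩, h₃, h₄⟩
    exact ⟨h₁, h₂, h₃, h₄⟩
  · intro s t _ _ hst
    simp only [Prod.mk.injEq] at hst
    ext c
    fin_cases c <;> simp [hst]
  · rintro ⟨a, b, c, d⟩ ⟨h₁, h₂, h₃, h₄⟩
    exact ⟨Finsupp.equivFunOnFinite.symm ![a, b, c, d], ⟨⟨h₁, h₂⟩, h₃, h₄⟩, rfl⟩

end
end

section
/- Let m_11, m_12, m_21 be integers with m_11 > m_21 ≥ 0 and m_12 ≥ m_21, set B = m_12 − m_11, and let I_Z = (x_0,x_2)^{m_11} ∩ (x_0,x_3)^{m_12} ∩ (x_1,x_2)^{m_21}. Then for every (a,b) ∈ ℕ²: β_0,(a,b)(I_Z) = 1 if (a,b) ∈ D_1; β_0,(a,b)(I_Z) = φ_{m_21+B, B}(b) if (a,b) ∈ D_2; β_0,(a,b)(I_Z) = 1 + φ_{m_21+B, B}(b) if (a,b) ∈ D_3; β_0,(a,b)(I_Z) = 1 if (a,b) ∈ D_4; and β_0,(a,b)(I_Z) = 0 otherwise. -/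
open MvPolynomial Module

noncomputable section

variable (k : Type*) [Field k] [CharZero k]

section MonomialIdeals

open scoped Pointwise

variable {σ R : Type*} [CommSemiring R]

theorem mem_span_monomial_iff_of_isUpperSet {S : Set (σ →₀ ℕ)} (hS : IsUpperSet S)
    (f : MvPolynomial σ R) :
    f ∈ Ideal.span ((fun d => monomial d (1 : R)) '' S) ↔ ∀ d ∈ f.support, d ∈ S := by
  rw [mem_ideal_span_monomial_image]
  exact forall₂_congr fun d _ => ⟨fun ⟨s, hs, hle⟩ => hS hle hs, fun h => ⟨d, h, le_rfl⟩⟩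

theorem span_X_pair_pow_s5 {i j : σ} (hij : i ≠ j) (m : ℕ) :
    Ideal.span {(X i : MvPolynomial σ R), X j} ^ m =
      Ideal.span ((fun d => monomial d (1 : R)) '' {d | m ≤ d i + d j}) := by
  classical
  induction m with
  | zero =>
    rw [pow_zero, Ideal.one_eq_top, eq_comm, Ideal.eq_top_iff_one]
    exact Ideal.subset_span ⟨0, by simp, rfl⟩
  | succ m ih =>
    rw [pow_succ, ih, Ideal.span_mul_span']
    apply le_antisymm
    · refine Ideal.span_le.2 ?_
      rintro _ ⟨_, ⟨d, hd, rfl⟩, _, he, rfl⟩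
      have hd' : m ≤ d i + d j := hd
      rcases he with rfl | rfl
      · refine Ideal.subset_span ⟨d + Finsupp.single i 1, ?_, by simp [X, monomial_mul]⟩
        simp [hij]
        omega
      · refine Ideal.subset_span ⟨d + Finsupp.single j 1, ?_, by simp [X, monomial_mul]⟩
        simp [hij.symm]
        omega
    · refine Ideal.span_le.2 ?_
      rintro _ ⟨d, hd, rfl⟩
      have hd' : m + 1 ≤ d i + d j := hd
      have key : ∀ l : σ, (X l : MvPolynomial σ R) ∈ ({X i, X j} : Set (MvPolynomial σ R)) →
          d l ≠ 0 → m ≤ (d - Finsupp.single l 1 : σ →₀ ℕ) i + (d - Finsupp.single l 1 : σ →₀ ℕ) j →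
          monomial d (1 : R) ∈ Ideal.span
            ((fun d => monomial d (1 : R)) '' {d | m ≤ d i + d j} * {X i, X j}) := by
        intro l hl h0 hm
        refine Ideal.subset_span ⟨_, ⟨d - Finsupp.single l 1, hm, rfl⟩, X l, hl, ?_⟩
        have hle : Finsupp.single l 1 ≤ d := Finsupp.single_le_iff.2 (Nat.one_le_iff_ne_zero.2 h0)
        simp [X, monomial_mul, tsub_add_cancel_of_le hle]
      by_cases hi : d i = 0
      · refine key j (by simp) (by omega) ?_
        simp [hij.symm]
        omega
      · refine key i (by simp) hi ?_
        simp [hij]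
        omega

theorem mem_span_X_pair_pow {i j : σ} (hij : i ≠ j) (m : ℕ) (f : MvPolynomial σ R) :
    f ∈ Ideal.span {(X i : MvPolynomial σ R), X j} ^ m ↔ ∀ d ∈ f.support, m ≤ d i + d j := by
  rw [span_X_pair_pow_s5 hij, mem_span_monomial_iff_of_isUpperSet]
  · rfl
  · intro d e hde hd
    exact le_trans hd (add_le_add (hde i) (hde j))

end MonomialIdeals

/-- The exponents of the monomials in `I_Z`. -/
def expIZ (p q r : ℕ) : Set (Fin 4 →₀ ℕ) :=
  {d | p ≤ d 0 + d 2 ∧ q ≤ d 0 + d 3 ∧ r ≤ d 1 + d 2}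

theorem isUpperSet_expIZ (p q r : ℕ) : IsUpperSet (expIZ p q r) := fun d e hde hd => by
  have h (i : Fin 4) : d i ≤ e i := hde i
  exact ⟨hd.1.trans (add_le_add (h _) (h _)), hd.2.1.trans (add_le_add (h _) (h _)),
    hd.2.2.trans (add_le_add (h _) (h _))⟩

/-- The exponents of the monomials in `𝔪 · I_Z`. -/
def expMulIZ (p q r : ℕ) : Set (Fin 4 →₀ ℕ) :=
  {d | ∃ i, ∃ e ∈ expIZ p q r, e + Finsupp.single i 1 = d}

theorem isUpperSet_expMulIZ (p q r : ℕ) : IsUpperSet (expMulIZ p q r) := by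
  rintro _ d' hde ⟨i, e, he, rfl⟩
  have h : e + Finsupp.single i 1 + (d' - (e + Finsupp.single i 1)) = d' :=
    add_tsub_cancel_of_le hde
  refine ⟨i, e + (d' - (e + Finsupp.single i 1)), isUpperSet_expIZ p q r le_self_add he, ?_⟩
  rw [add_right_comm, h]

section

variable {K : Type*} [Field K]

theorem mem_IZ_iff (p q r : ℕ) (f : MvPolynomial (Fin 4) K) :
    f ∈ IZ K p q r ↔ ∀ d ∈ f.support, d ∈ expIZ p q r := by
  simp only [IZ, I11, I12, I21, Submodule.mem_inf,
    mem_span_X_pair_pow (show (0 : Fin 4) ≠ 2 by decide),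
    mem_span_X_pair_pow (show (0 : Fin 4) ≠ 3 by decide),
    mem_span_X_pair_pow (show (1 : Fin 4) ≠ 2 by decide), expIZ, Set.mem_ofPred_eq]
  exact ⟨fun h d hd => ⟨h.1.1 d hd, h.1.2 d hd, h.2 d hd⟩,
    fun h => ⟨⟨fun d hd => (h d hd).1, fun d hd => (h d hd).2.1⟩, fun d hd => (h d hd).2.2⟩⟩

theorem IZ_eq_span (p q r : ℕ) :
    IZ K p q r = Ideal.span ((fun d => monomial d (1 : K)) '' expIZ p q r) := by
  ext f
  rw [mem_IZ_iff, mem_span_monomial_iff_of_isUpperSet (isUpperSet_expIZ p q r)]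

open scoped Pointwise in
theorem mem_mIdeal_mul_IZ_iff (p q r : ℕ) (f : MvPolynomial (Fin 4) K) :
    f ∈ mIdeal K * IZ K p q r ↔ ∀ d ∈ f.support, d ∈ expMulIZ p q r := by
  rw [← mem_span_monomial_iff_of_isUpperSet (isUpperSet_expMulIZ p q r), IZ_eq_span, mIdeal,
    Ideal.span_mul_span']
  suffices h : ({X 0, X 1, X 2, X 3} : Set (MvPolynomial (Fin 4) K)) *
      (fun d => monomial d (1 : K)) '' expIZ p q r =
      (fun d => monomial d (1 : K)) '' expMulIZ p q r by rw [h]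
  have hX : ({X 0, X 1, X 2, X 3} : Set (MvPolynomial (Fin 4) K)) = Set.range X := by
    ext g
    simp [Fin.exists_fin_succ, eq_comm]
  rw [hX]
  ext g
  constructor
  · rintro ⟨_, ⟨i, rfl⟩, _, ⟨e, he, rfl⟩, rfl⟩
    exact ⟨_, ⟨i, e, he, rfl⟩, by simp [X, monomial_mul, add_comm]⟩
  · rintro ⟨_, ⟨i, e, he, rfl⟩, rfl⟩
    exact ⟨X i, ⟨i, rfl⟩, _, ⟨e, he, rfl⟩, by simp [X, monomial_mul, add_comm]⟩

/-- The exponents of bidegree `(a, b)`. -/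
def expComp (a b : ℕ) : Set (Fin 4 →₀ ℕ) := {d | d 0 + d 1 = a ∧ d 2 + d 3 = b}

theorem weight_w (d : Fin 4 →₀ ℕ) : Finsupp.weight w d = (d 0 + d 1, d 2 + d 3) := by
  ext <;> simp [Finsupp.weight_apply, Finsupp.sum_fintype, Fin.sum_univ_four, w]

theorem mem_comp_iff (a b : ℕ) (f : MvPolynomial (Fin 4) K) :
    f ∈ comp K a b ↔ ∀ d ∈ f.support, d ∈ expComp a b := by
  simp [comp, mem_weightedHomogeneousSubmodule, IsWeightedHomogeneous, weight_w, expComp]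

theorem finite_expComp (a b : ℕ) : (expComp a b).Finite := by
  refine Set.Finite.subset (Set.finite_Iic (Finsupp.equivFunOnFinite.symm ![a, a, b, b])) ?_
  intro d hd i
  have h1 : d 0 + d 1 = a := hd.1
  have h2 : d 2 + d 3 = b := hd.2
  fin_cases i <;> simp <;> omega

theorem finrank_inf_comp_s5 {I : Ideal (MvPolynomial (Fin 4) K)} {S : Set (Fin 4 →₀ ℕ)}
    (hI : ∀ f, f ∈ I ↔ ∀ d ∈ f.support, d ∈ S) (a b : ℕ) :
    finrank K ↥(I.restrictScalars K ⊓ comp K a b) = (S ∩ expComp a b).ncard := by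
  have h : I.restrictScalars K ⊓ comp K a b = restrictSupport K (S ∩ expComp a b) := by
    ext f
    rw [Submodule.mem_inf, Submodule.restrictScalars_mem, hI, mem_comp_iff,
      mem_restrictSupport_iff]
    exact ⟨fun h d hd => ⟨h.1 d hd, h.2 d hd⟩,
      fun h => ⟨fun d hd => (h hd).1, fun d hd => (h hd).2⟩⟩
  rw [h, finrank_eq_nat_card_basis (basisRestrictSupport K _), Nat.card_coe_set_eq]

end

theorem expMulIZ_subset (p q r : ℕ) : expMulIZ p q r ⊆ expIZ p q r := by
  rintro _ ⟨i, e, he, rfl⟩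
  exact isUpperSet_expIZ p q r le_self_add he

/-- The values at `x₀` and `x₂` of the exponents of the minimal generators of `I_Z` of
bidegree `(a, b)`. -/
def minGens (p q r a b : ℕ) : Set (ℕ × ℕ) :=
  {x | p ≤ x.1 + x.2 ∧ (x.1 + x.2 = p ∨ x.1 ≤ q ∧ x.2 ≤ r) ∧
    x.1 + (r - x.2) = a ∧ x.2 + (q - x.1) = b}

theorem notMem_expMulIZ_iff (p q r : ℕ) (d : Fin 4 →₀ ℕ) :
    d ∉ expMulIZ p q r ↔ ∀ i, d i ≠ 0 → d - Finsupp.single i 1 ∉ expIZ p q r := by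
  constructor
  · rintro h i hi hd
    exact h ⟨i, _, hd, tsub_add_cancel_of_le
      (Finsupp.single_le_iff.2 (Nat.one_le_iff_ne_zero.2 hi))⟩
  · rintro h ⟨i, e, he, rfl⟩
    exact h i (by simp) (by simpa using he)

theorem ncard_expIZ_diff (p q r a b : ℕ) :
    ((expIZ p q r ∩ expComp a b) \ (expMulIZ p q r ∩ expComp a b)).ncard =
      (minGens p q r a b).ncard := by
  have h : ∀ d, d ∈ (expIZ p q r ∩ expComp a b) \ (expMulIZ p q r ∩ expComp a b) ↔
      (d 0, d 2) ∈ minGens p q r a b ∧ d 1 = r - d 2 ∧ d 3 = q - d 0 := by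
    intro d
    have h' : d ∈ (expIZ p q r ∩ expComp a b) \ (expMulIZ p q r ∩ expComp a b) ↔
        d ∈ expIZ p q r ∧ d ∉ expMulIZ p q r ∧ d ∈ expComp a b := by
      simp only [Set.mem_sdiff, Set.mem_inter_iff]
      tauto
    rw [h', notMem_expMulIZ_iff]
    simp only [Fin.forall_fin_succ, expIZ, expComp, minGens, Set.mem_ofPred_eq,
      Finsupp.tsub_apply, Finsupp.single_apply]
    simp
    omega
  refine Set.ncard_congr (fun d _ => (d 0, d 2)) (fun d hd => ((h d).1 hd).1) ?_ ?_
  · intro d e hd he hde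
    have h0 : d 0 = e 0 := congrArg Prod.fst hde
    have h2 : d 2 = e 2 := congrArg Prod.snd hde
    have hd' := ((h d).1 hd).2
    have he' := ((h e).1 he).2
    ext i
    fin_cases i <;> simp <;> omega
  · rintro ⟨u, v⟩ hx
    refine ⟨Finsupp.equivFunOnFinite.symm ![u, r - v, v, q - u], (h _).2 ?_, by simp⟩
    simpa using hx

theorem beta0_IZ {K : Type*} [Field K] [CharZero K] (p q r a b : ℕ) :
    beta0 K (IZ K p q r) a b = (minGens p q r a b).ncard := by
  rw [beta0, finrank_inf_comp_s5 (mem_IZ_iff p q r), finrank_inf_comp_s5 (mem_mIdeal_mul_IZ_iff p q r),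
    ← ncard_expIZ_diff]
  have hsub : expMulIZ p q r ∩ expComp a b ⊆ expIZ p q r ∩ expComp a b :=
    Set.inter_subset_inter_left _ (expMulIZ_subset p q r)
  have hfin : (expIZ p q r ∩ expComp a b).Finite :=
    (finite_expComp a b).subset Set.inter_subset_right
  have := Set.ncard_sdiff_add_ncard_of_subset hsub hfin
  omega

theorem phiNat_eq (t : ℕ) (n : ℤ) :
    phiNat t n = if 0 ≤ n ∧ n + 2 ≤ 2 * t then min (n / 2 + 1) ((2 * t - n) / 2) else 0 := by
  induction t using Nat.twoStepInduction generalizing n with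
  | zero => rw [phiNat]; split_ifs <;> omega
  | one => rw [phiNat]; split_ifs <;> push_cast at * <;> omega
  | more t _ ih =>
    rw [phiNat, ih]
    push_cast
    split_ifs <;> omega

theorem phi_eq (t n : ℤ) :
    phi t n = if 0 ≤ n ∧ n + 2 ≤ 2 * t then min (n / 2 + 1) ((2 * t - n) / 2) else 0 := by
  rw [phi, phiNat_eq]
  split_ifs <;> omega

/-- On the antidiagonal `a + b = q + r`, the minimal generators lie on a segment. -/
theorem ncard_minGens_of_add_eq {p q r a b : ℕ} (hr : r < p) (hab : a + b = q + r) :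
    (minGens p q r a b).ncard = min r b + 1 - (p + r + 1 - a) / 2 := by
  have h : minGens p q r a b =
      ((Finset.Icc ((p + r + 1 - a) / 2) (min r b)).image fun v => (v + a - r, v) : Set _) := by
    ext ⟨u, v⟩
    simp [minGens]
    omega
  rw [h, Set.ncard_coe_finset,
    Finset.card_image_of_injective _ fun x y hxy => congrArg Prod.snd hxy,
    Nat.card_Icc]

theorem ncard_minGens_eq_one {p q r a b u v : ℕ}
    (h : ∀ x y, (x, y) ∈ minGens p q r a b ↔ x = u ∧ y = v) :
    (minGens p q r a b).ncard = 1 := by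
  rw [Set.ncard_eq_one]
  exact ⟨(u, v), by ext ⟨x, y⟩; rw [h]; simp⟩

/-- Theorem 4.5 (second case `m₁₁ > m₂₁`): the bigraded Betti numbers in homological
degree zero of `I_Z`, described via the regions `D₁, D₂, D₃, D₄` (with `B = m₁₂ − m₁₁`). -/
theorem beta0_three_fat_points_case2 (m11 m12 m21 : ℕ)
    (h1 : m21 < m11) (h2 : m21 ≤ m12) (a b : ℕ) :
    ((a, b) ∈ D1set m11 m12 m21 → beta0 k (IZ k m11 m12 m21) a b = 1) ∧
    ((a, b) ∈ D2set m11 m12 m21 → beta0 k (IZ k m11 m12 m21) a b =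
        phi2 ((m21 : ℤ) + ((m12 : ℤ) - m11)) ((m12 : ℤ) - m11) b) ∧
    ((a, b) ∈ D3set m11 m12 m21 → beta0 k (IZ k m11 m12 m21) a b =
        1 + phi2 ((m21 : ℤ) + ((m12 : ℤ) - m11)) ((m12 : ℤ) - m11) b) ∧
    ((a, b) ∈ D4set m11 m12 m21 → beta0 k (IZ k m11 m12 m21) a b = 1) ∧
    ((a, b) ∉ D1set m11 m12 m21 ∪ D2set m11 m12 m21 ∪ D3set m11 m12 m21 ∪ D4set m11 m12 m21 →
      beta0 k (IZ k m11 m12 m21) a b = 0) := by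
  have abs_eq : |((m12 : ℤ) - m11) + m21| =
      max (((m12 : ℤ) - m11) + m21) (-(((m12 : ℤ) - m11) + m21)) := rfl
  simp only [D1set, D2set, D3set, D4set, Set.mem_union, Set.mem_ofPred_eq, beta0_IZ, abs_eq,
    pos, Dbound, phi2, phi_eq]
  refine ⟨fun h => ?_, fun h => ?_, fun h => ?_, fun h => ?_, fun h => ?_⟩
  · rw [ncard_minGens_eq_one (u := m11 - b) (v := b), Nat.cast_one]
    intro x y
    simp only [minGens, Set.mem_ofPred_eq]
    omega
  · rw [ncard_minGens_of_add_eq h1 (by omega)]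
    split_ifs <;> omega
  · rcases lt_or_ge m11 (m12 + m21) with hlt | hge
    · rw [ncard_minGens_of_add_eq h1 (by omega)]
      split_ifs <;> omega
    · rw [ncard_minGens_eq_one (u := a) (v := b)]
      · split_ifs <;> omega
      · intro x y
        simp only [minGens, Set.mem_ofPred_eq]
        omega
  · rw [ncard_minGens_eq_one (u := a) (v := m11 - a), Nat.cast_one]
    intro x y
    simp only [minGens, Set.mem_ofPred_eq]
    omega
  · have hempty : minGens m11 m12 m21 a b = ∅ := by
      ext ⟨x, y⟩
      simp only [minGens, Set.mem_ofPred_eq, Set.mem_empty_iff_false, iff_false]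
      omega
    rw [hempty, Set.ncard_empty, Nat.cast_zero]

end
end

section
/- Let m_11, m_12, m_21 be integers with m_11 > m_21 ≥ 0 and m_12 ≥ m_21, and let D_1, D_2, D_3, D_4 be the sets associated to (m_11, m_12, m_21). If (a,b) ∈ D_i for some i ∈ {1,2,3,4}, then for every j ∈ {1,2,3,4} and every (a',b') ∈ D_j: a' = a implies b' = b, and b' = b implies a' = a (i.e., no other element of D_1 ∪ D_2 ∪ D_3 ∪ D_4 shares the first or the second coordinate with (a,b)). -/
open MvPolynomial Module

noncomputable section

variable (k : Type*) [Field k] [CharZero k]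

/-- Along `D₁ ∪ D₂ ∪ D₃ ∪ D₄`, the first coordinate strictly decreases as the second increases. -/
theorem Dset_fst_lt_of_snd_lt {m11 m12 m21 a b a' b' : ℕ}
    (h : (a, b) ∈ D1set m11 m12 m21 ∪ D2set m11 m12 m21 ∪ D3set m11 m12 m21 ∪ D4set m11 m12 m21)
    (h' : (a', b') ∈
      D1set m11 m12 m21 ∪ D2set m11 m12 m21 ∪ D3set m11 m12 m21 ∪ D4set m11 m12 m21)
    (hb : b < b') : a' < a := by
  simp only [Set.mem_union, D1set, D2set, D3set, D4set, Set.mem_ofPred_eq, Dbound, pos] at h h'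
  rcases abs_cases ((m12 : ℤ) - m11 + m21) with ⟨e, _⟩ | ⟨e, _⟩ <;> rw [e] at h h' <;>
    rcases h with ((h | h) | h) | h <;> rcases h' with ((h' | h') | h') | h' <;> omega

/-- The first coordinate on `D₁ ∪ D₂ ∪ D₃ ∪ D₄` is determined by the second. -/
theorem Dset_fst_eq_of_snd_eq {m11 m12 m21 a b a' : ℕ}
    (h : (a, b) ∈ D1set m11 m12 m21 ∪ D2set m11 m12 m21 ∪ D3set m11 m12 m21 ∪ D4set m11 m12 m21)
    (h' : (a', b) ∈
      D1set m11 m12 m21 ∪ D2set m11 m12 m21 ∪ D3set m11 m12 m21 ∪ D4set m11 m12 m21) :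
    a' = a := by
  simp only [Set.mem_union, D1set, D2set, D3set, D4set, Set.mem_ofPred_eq, Dbound, pos] at h h'
  have := abs_nonneg ((m12 : ℤ) - m11 + m21)
  rcases h with ((h | h) | h) | h <;> rcases h' with ((h' | h') | h') | h' <;> omega

/-- Remark 4.4(vi): no two distinct elements of `D₁ ∪ D₂ ∪ D₃ ∪ D₄` share the first
or the second coordinate. -/
theorem Dset_coords_unique (m11 m12 m21 : ℕ) (h1 : m21 < m11) (h2 : m21 ≤ m12)
    (a b : ℕ)
    (h : (a, b) ∈ D1set m11 m12 m21 ∪ D2set m11 m12 m21 ∪ D3set m11 m12 m21 ∪ D4set m11 m12 m21) :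
    ∀ a' b' : ℕ,
      (a', b') ∈ D1set m11 m12 m21 ∪ D2set m11 m12 m21 ∪ D3set m11 m12 m21 ∪ D4set m11 m12 m21 →
      (a' = a → b' = b) ∧ (b' = b → a' = a) := by
  refine fun a' b' h' => ⟨fun ha => ?_, fun hb => ?_⟩
  · rcases lt_trichotomy b' b with hb | hb | hb
    · exact absurd (Dset_fst_lt_of_snd_lt h' h hb) (by omega)
    · exact hb
    · exact absurd (Dset_fst_lt_of_snd_lt h h' hb) (by omega)
  · subst hb
    exact Dset_fst_eq_of_snd_eq h h'

end
end
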